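/- Let X and Y be centered Gaussian random vectors in R^k satisfying E[(X_i − X_j)^2] ≤ E[(Y_i − Y_j)^2] for all 1 ≤ i, j ≤ k, and suppose moreover that max_{1≤i≤k} E[X_i^2] ≤ max_{1≤i≤k} E[Y_i^2]. Then for every real m ≥ 1, E[(max_{1≤i≤k} |X_i|)^m] ≤ 2^{m−1} · (2^{m/2} + 1) · E[(max_{1≤i≤k} |Y_i|)^m]. -/

import Mathlib

open MeasureTheory ProbabilityTheory Real
open scoped NNReal BigOperators

/-- A random vector `X` on `(Ω, P)` is a centered Gaussian random vector if every
linear combination of its coordinates is a centered real Gaussian random variable. -/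
def IsCenteredGaussianVec {Ω : Type*} [MeasurableSpace Ω] {k : ℕ}
    (P : Measure Ω) (X : Ω → Fin k → ℝ) : Prop :=
  ∀ a : Fin k → ℝ,
    Measure.map (fun ω => ∑ i, a i * X ω i) P
      = gaussianReal 0 (variance (fun ω => ∑ i, a i * X ω i) P).toNNReal


lemma stein_one {v : ℝ≥0} (hv : v ≠ 0) (h h' : ℝ → ℝ) (C : ℝ)
    (hd : ∀ x, HasDerivAt h (h' x) x) (hc' : Continuous h')
    (hb : ∀ x, |h x| ≤ C) (hb' : ∀ x, |h' x| ≤ C) :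
    ∫ x, x * h x ∂(gaussianReal 0 v) = v * ∫ x, h' x ∂(gaussianReal 0 v) := by
  have hcont : Continuous h := continuous_iff_continuousAt.2 fun x => (hd x).continuousAt
  have hv' : (v : ℝ) ≠ 0 := by exact_mod_cast hv
  have hint : Integrable (fun x => x * gaussianPDFReal 0 v x) := by
    have h1 : Integrable (fun x : ℝ => x) (gaussianReal 0 v) := 
      (memLp_id_gaussianReal 1).integrable le_rfl
    rw [gaussianReal_of_var_ne_zero _ hv, integrable_withDensity_iff_integrable_smul' 
      (by fun_prop) (by simp [gaussianPDF])] at h1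
    simpa [mul_comm] using h1
  have hderiv : ∀ x, HasDerivAt (gaussianPDFReal 0 v) (-(x / v) * gaussianPDFReal 0 v x) x := by
    intro x
    unfold gaussianPDFReal
    have := (((hasDerivAt_id x).sub_const 0).pow 2).neg.div_const (2 * (v:ℝ))
    convert! (this.exp.const_mul (√(2 * π * v))⁻¹) using 1
    simp
    field_simp
  rw [integral_gaussianReal_eq_integral_smul hv, integral_gaussianReal_eq_integral_smul hv]
  have key := integral_mul_deriv_eq_deriv_mul_of_integrable (u := h) (u' := h') (v := gaussianPDFReal 0 v)
    (v' := fun x => -(x / v) * gaussianPDFReal 0 v x) (fun x _ => hd x) (fun x _ => hderiv x)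
    ?_ ?_ ?_
  · have e1 : ∫ x, gaussianPDFReal 0 v x • (x * h x) = -(v:ℝ) * ∫ x, h x * (-(x / v) * gaussianPDFReal 0 v x) := by
      rw [← integral_const_mul]
      congr with x
      simp; field_simp
    rw [e1, key]
    simp [mul_comm]
  · refine (Integrable.bdd_mul (c := C) (f := h) (g := fun x => -(x / v) * gaussianPDFReal 0 v x) ?_ (by fun_prop) (.of_forall hb))
    convert! hint.const_mul (-(1 / (v:ℝ))) using 2 with x
    ring
  · exact Integrable.bdd_mul (c := C) (integrable_gaussianPDFReal 0 v) (by fun_prop) (.of_forall hb')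
  · exact Integrable.bdd_mul (c := C) (integrable_gaussianPDFReal 0 v) (by fun_prop) (.of_forall hb)

lemma gaussian_ibp {Ω ι : Type*} [MeasurableSpace Ω] [Fintype ι] {P : Measure Ω}
    {W : Ω → ℝ} {Z : Ω → ι → ℝ}
    (hWZ : HasGaussianLaw (fun ω => (W ω, Z ω)) P) (hW0 : ∫ ω, W ω ∂P = 0)
    (H : (ι → ℝ) → ℝ) (H' : ι → (ι → ℝ) → ℝ) (C : ℝ)
    (hd : ∀ (c z : ι → ℝ) (t : ℝ), HasDerivAt (fun t : ℝ => H (t • c + z))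
      (∑ j, c j * H' j (t • c + z)) t)
    (hc : Continuous H) (hc' : ∀ j, Continuous (H' j))
    (hb : ∀ z, |H z| ≤ C) (hb' : ∀ j z, |H' j z| ≤ C) :
    ∫ ω, W ω * H (Z ω) ∂P = ∑ j, cov[W, fun ω => Z ω j; P] * ∫ ω, H' j (Z ω) ∂P := by
  have := hWZ.isProbabilityMeasure
  have hWg : HasGaussianLaw W P := hWZ.fst
  have hZg : HasGaussianLaw Z P := hWZ.snd
  have hWm := hWg.aemeasurable
  have hZm := hZg.aemeasurable
  have hZj : ∀ j, HasGaussianLaw (fun ω => Z ω j) P := fun j =>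
    hZg.map_fun (ContinuousLinearMap.proj (R := ℝ) (φ := fun _ : ι => ℝ) j)
  have hlaw := hWg.map_eq_gaussianReal
  rw [hW0] at hlaw
  by_cases hv : Var[W; P].toNNReal = 0
  · rw [hv, gaussianReal_zero_var] at hlaw
    have hW : W =ᵐ[P] 0 := by
      have : ∀ᵐ x ∂(P.map W), x = 0 := by rw [hlaw]; simp [ae_dirac_eq]
      exact ae_of_ae_map hWm this
    have h1 : ∀ j, cov[W, fun ω => Z ω j; P] = 0 := by
      intro j
      rw [covariance, hW0]
      apply integral_eq_zero_of_ae
      filter_upwards [hW] with ω h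
      simp [h]
    simp only [h1, zero_mul, Finset.sum_const_zero]
    apply integral_eq_zero_of_ae
    filter_upwards [hW] with ω h
    simp [h]
  set v := Var[W; P].toNNReal with hvdef
  have hvv : (v : ℝ) = Var[W; P] := Real.coe_toNNReal _ (variance_nonneg _ _)
  have hv0 : (v : ℝ) ≠ 0 := by exact_mod_cast hv
  set c : ι → ℝ := fun j => cov[W, fun ω => Z ω j; P] / v with hcdef
  set R : Ω → ι → ℝ := fun ω j => Z ω j - c j * W ω with hR
  have hWR : HasGaussianLaw (fun ω => (W ω, R ω)) P := by
    let L : (ℝ × (ι → ℝ)) →L[ℝ] (ℝ × (ι → ℝ)) :=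
      (ContinuousLinearMap.fst ℝ ℝ (ι → ℝ)).prod
        (ContinuousLinearMap.snd ℝ ℝ (ι → ℝ) - (ContinuousLinearMap.fst ℝ ℝ (ι → ℝ)).smulRight c)
    convert! hWZ.map_fun L using 2 with ω
    simp [L, hR]
    ext j
    simp [mul_comm]
  have hRm := hWR.snd.aemeasurable
  have hind : IndepFun W R P := by
    have h2 : HasGaussianLaw (fun ω => ((fun _ : Unit => W ω), fun j => R ω j)) P := by
      let L : (ℝ × (ι → ℝ)) →L[ℝ] ((Unit → ℝ) × (ι → ℝ)) :=
        (ContinuousLinearMap.pi fun _ => ContinuousLinearMap.fst ℝ ℝ (ι → ℝ)).prod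
          (ContinuousLinearMap.snd ℝ ℝ (ι → ℝ))
      exact hWR.map_fun L
    have h3 := HasGaussianLaw.indepFun_of_covariance_eval (X := fun _ : Unit => W) 
      (Y := fun j ω => R ω j) h2 ?_
    · exact h3.comp (φ := fun f : Unit → ℝ => f ()) (ψ := id) (by fun_prop) (by fun_prop)
    intro _ j
    simp only [hR]
    rw [covariance_fun_sub_right hWg.memLp_two (hZj j).memLp_two (hWg.memLp_two.const_mul _),
      covariance_const_mul_right, covariance_self hWm, ← hvv]
    simp only [hcdef]
    field_simp
    simp
  have hprod := (indepFun_iff_map_prod_eq_prod_map_map hWm hRm).1 hind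
  have hZ : ∀ ω, Z ω = W ω • c + R ω := by
    intro ω; ext j; simp [hR, mul_comm]
  have hWRm : AEMeasurable (fun ω => (W ω, R ω)) P := hWm.prodMk hRm
  have : IsProbabilityMeasure (P.map R) := Measure.isProbabilityMeasure_map hRm
  have hi1 : Integrable (fun p : ℝ × (ι → ℝ) => p.1 * H (p.1 • c + p.2)) ((P.map W).prod (P.map R)) := by
    rw [← hprod]
    rw [integrable_map_measure (by fun_prop) hWRm]
    refine Integrable.mul_bdd (c := C) hWg.integrable ?_ (.of_forall fun _ => hb _)
    exact (Continuous.comp_aestronglyMeasurable (g := fun p : ℝ × (ι → ℝ) => H (p.1 • c + p.2)) (by fun_prop) hWRm.aestronglyMeasurable)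
  have hi2 : ∀ j, Integrable (fun p : ℝ × (ι → ℝ) => H' j (p.1 • c + p.2)) ((P.map W).prod (P.map R)) := by
    intro j
    rw [hlaw]
    refine Integrable.of_bound (C := C) ?_ (.of_forall fun _ => hb' _ _)
    have := hc' j
    exact Continuous.aestronglyMeasurable (by fun_prop)
  have e1 : ∫ ω, W ω * H (Z ω) ∂P = ∫ r, ∫ w, w * H (w • c + r) ∂(P.map W) ∂(P.map R) := by
    rw [← integral_prod_symm _ hi1, ← hprod, integral_map hWRm (by fun_prop)]
    simp only [← hZ]
  have e2 : ∀ j, ∫ ω, H' j (Z ω) ∂P = ∫ r, ∫ w, H' j (w • c + r) ∂(P.map W) ∂(P.map R) := by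
    intro j
    have := hc' j
    rw [← integral_prod_symm _ (hi2 j), ← hprod, integral_map hWRm (by fun_prop)]
    simp only [← hZ]
  have e3 : ∀ r, ∫ w, w * H (w • c + r) ∂(P.map W) = ∑ j, (v * c j) * ∫ w, H' j (w • c + r) ∂(P.map W) := by
    intro r
    rw [hlaw, stein_one hv (fun w => H (w • c + r)) (fun w => ∑ j, c j * H' j (w • c + r)) 
      (max C (∑ j, |c j| * C)) (fun t => hd c r t) (by fun_prop) 
      (fun _ => le_max_of_le_left (hb _)) ?_]
    · rw [integral_finsetSum, Finset.mul_sum]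
      · simp_rw [integral_const_mul, mul_assoc]
      · intro j _
        refine Integrable.const_mul ?_ _
        refine Integrable.of_bound (C := C) ?_ (.of_forall fun _ => hb' _ _)
        have := hc' j
        exact Continuous.aestronglyMeasurable (by fun_prop)
    · intro x
      refine le_max_of_le_right ((Finset.abs_sum_le_sum_abs _ _).trans (Finset.sum_le_sum fun j _ => ?_))
      rw [abs_mul]
      exact mul_le_mul_of_nonneg_left (hb' _ _) (abs_nonneg _)
  rw [e1]
  simp_rw [e3, e2]
  rw [integral_finsetSum]
  · refine Finset.sum_congr rfl fun j _ => ?_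
    rw [integral_const_mul]
    congr 1
    simp only [hcdef]; field_simp
  · intro j _
    exact ((hi2 j).integral_prod_right).const_mul _

noncomputable def lse {ι : Type*} [Fintype ι] (c z : ι → ℝ) : ℝ := Real.log (∑ i, Real.exp (z i + c i))

noncomputable def smx {ι : Type*} [Fintype ι] (c : ι → ℝ) (i : ι) (z : ι → ℝ) : ℝ :=
  Real.exp (z i + c i) / ∑ j, Real.exp (z j + c j)

section
variable {ι : Type*} [Fintype ι] [Nonempty ι] (c : ι → ℝ)

lemma sexp_pos (z : ι → ℝ) : 0 < ∑ j, Real.exp (z j + c j) :=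
  Finset.sum_pos (fun _ _ => Real.exp_pos _) Finset.univ_nonempty

lemma smx_nonneg (i : ι) (z : ι → ℝ) : 0 ≤ smx c i z := by
  unfold smx; have := sexp_pos c z; positivity

lemma smx_sum (z : ι → ℝ) : ∑ i, smx c i z = 1 := by
  unfold smx
  rw [← Finset.sum_div, div_self (sexp_pos c z).ne']

lemma smx_le_one (i : ι) (z : ι → ℝ) : smx c i z ≤ 1 := by
  rw [← smx_sum c z]
  exact Finset.single_le_sum (f := fun i => smx c i z) (fun i _ => smx_nonneg c i z) (Finset.mem_univ i)

lemma smx_abs_le (i : ι) (z : ι → ℝ) : |smx c i z| ≤ 1 := by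
  rw [abs_of_nonneg (smx_nonneg c i z)]; exact smx_le_one c i z

lemma smx_cont (i : ι) : Continuous (smx c i) := by
  unfold smx
  exact Continuous.div (by fun_prop) (by fun_prop) fun z => (sexp_pos c z).ne'

lemma lse_cont : Continuous (lse c) := by
  unfold lse
  exact Continuous.log (by fun_prop) fun z => (sexp_pos c z).ne'

lemma lse_deriv (z : ℝ → ι → ℝ) (z' : ι → ℝ) (t : ℝ) (h : ∀ i, HasDerivAt (fun t => z t i) (z' i) t) :
    HasDerivAt (fun t => lse c (z t)) (∑ i, smx c i (z t) * z' i) t := by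
  unfold lse
  have h1 : HasDerivAt (fun t => ∑ i, Real.exp (z t i + c i)) (∑ i, Real.exp (z t i + c i) * z' i) t :=
    HasDerivAt.fun_sum fun i _ => ((h i).add_const (c i)).exp
  convert! h1.log (sexp_pos c (z t)).ne' using 1
  rw [Finset.sum_div]
  refine Finset.sum_congr rfl fun i _ => ?_
  unfold smx; ring

lemma smx_deriv [DecidableEq ι] (k : ι) (z : ℝ → ι → ℝ) (z' : ι → ℝ) (t : ℝ) (h : ∀ i, HasDerivAt (fun t => z t i) (z' i) t) :
    HasDerivAt (fun t => smx c k (z t))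
      (∑ j, z' j * (smx c k (z t) * ((if k = j then 1 else 0) - smx c j (z t)))) t := by
  have h1 : HasDerivAt (fun t => ∑ i, Real.exp (z t i + c i)) (∑ i, Real.exp (z t i + c i) * z' i) t :=
    HasDerivAt.fun_sum fun i _ => ((h i).add_const (c i)).exp
  have h2 := (((h k).add_const (c k)).exp).div h1 (sexp_pos c (z t)).ne'
  have hp := (sexp_pos c (z t)).ne'
  convert! h2 using 1
  have e : (∑ i, Real.exp (z t i + c i) * z' i) = (∑ i, Real.exp (z t i + c i)) * ∑ i, smx c i (z t) * z' i := by
    rw [Finset.mul_sum]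
    refine Finset.sum_congr rfl fun i _ => ?_
    unfold smx; field_simp
  have e2 : (∑ j, z' j * (smx c k (z t) * ((if k = j then 1 else 0) - smx c j (z t)))) =
     smx c k (z t) * (z' k - ∑ i, smx c i (z t) * z' i) := by
    simp only [mul_sub, Finset.sum_sub_distrib, Finset.mul_sum]
    simp
    congr 1
    · ring
    · exact Finset.sum_congr rfl fun i _ => by ring
  rw [e, e2]
  unfold smx
  field_simp

lemma lse_bound (z : ι → ℝ) : |lse c z| ≤ |lse c 0| + ∑ i, |z i| := by
  have key : ∀ z w : ι → ℝ, lse c z ≤ lse c w + ∑ i, |z i - w i| := by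
    intro z w
    unfold lse
    rw [← Real.log_exp (∑ i, |z i - w i|), ← Real.log_mul (sexp_pos c w).ne' (Real.exp_pos _).ne']
    apply Real.log_le_log (sexp_pos c z)
    rw [Finset.sum_mul]
    refine Finset.sum_le_sum fun i _ => ?_
    rw [← Real.exp_add, Real.exp_le_exp]
    have := Finset.single_le_sum (f := fun i => |z i - w i|) (fun i _ => abs_nonneg _) (Finset.mem_univ i)
    have h2 := le_abs_self (z i - w i)
    linarith
  have h1 := key z 0
  have h2 := key 0 z
  simp at h1 h2
  rw [abs_le]
  constructor
  · linarith [neg_abs_le (lse c 0)]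
  · linarith [le_abs_self (lse c 0)]

end

lemma sum_ident {ι : Type*} [Fintype ι] [DecidableEq ι] (p : ι → ℝ) (D : ι → ι → ℝ) (hp : ∀ i, 0 ≤ p i) (h1 : ∑ i, p i = 1)
    (hD : ∀ i j, 0 ≤ D i i + D j j - 2 * D i j) :
    0 ≤ ∑ i, ∑ j, D i j * (p i * ((if i = j then 1 else 0) - p j)) := by
  have e : ∑ i, ∑ j, D i j * (p i * ((if i = j then 1 else 0) - p j)) =
    1 / 2 * ∑ i, ∑ j, p i * p j * (D i i + D j j - 2 * D i j) := by
    have a1 : ∑ i, ∑ j, D i j * (p i * ((if i = j then 1 else 0) - p j)) =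
        ∑ i, p i * D i i - ∑ i, ∑ j, p i * p j * D i j := by
      simp only [mul_sub, Finset.sum_sub_distrib]
      simp
      congr 1
      · exact Finset.sum_congr rfl fun i _ => by ring
      · exact Finset.sum_congr rfl fun i _ => Finset.sum_congr rfl fun j _ => by ring
    have a2 : ∑ i, ∑ j, p i * p j * D i i = ∑ i, p i * D i i := by
      refine Finset.sum_congr rfl fun i _ => ?_
      rw [← Finset.sum_mul, ← Finset.mul_sum, h1, mul_one]
    have a3 : ∑ i, ∑ j, p i * p j * D j j = ∑ i, p i * D i i := by
      rw [Finset.sum_comm, ← a2]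
      exact Finset.sum_congr rfl fun i _ => Finset.sum_congr rfl fun j _ => by ring
    have a4 : ∑ i, ∑ j, p i * p j * (D i i + D j j - 2 * D i j) = 
       ∑ i, ∑ j, p i * p j * D i i + ∑ i, ∑ j, p i * p j * D j j - 2 * ∑ i, ∑ j, p i * p j * D i j := by
      simp only [Finset.mul_sum, ← Finset.sum_add_distrib, ← Finset.sum_sub_distrib]
      exact Finset.sum_congr rfl fun i _ => Finset.sum_congr rfl fun j _ => by ring
    rw [a1, a4, a2, a3]; ring
  rw [e]
  refine mul_nonneg (by norm_num) (Finset.sum_nonneg fun i _ => Finset.sum_nonneg fun j _ => ?_)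
  exact mul_nonneg (mul_nonneg (hp i) (hp j)) (hD i j)

lemma sf_lse {Ω ι : Type*} [MeasurableSpace Ω] [Fintype ι] [Nonempty ι] {P : Measure Ω}
    {A B : Ω → ι → ℝ} (hAB : HasGaussianLaw (fun ω => (A ω, B ω)) P)
    (hA0 : ∀ i, ∫ ω, A ω i ∂P = 0) (hB0 : ∀ i, ∫ ω, B ω i ∂P = 0)
    (hcov : ∀ i j, cov[fun ω => A ω i, fun ω => B ω j; P] = 0)
    (hinc : ∀ i j, Var[fun ω => A ω i - A ω j; P] ≤ Var[fun ω => B ω i - B ω j; P])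
    (c : ι → ℝ) :
    ∫ ω, lse c (A ω) ∂P ≤ ∫ ω, lse c (B ω) ∂P := by
  classical
  have := hAB.isProbabilityMeasure
  have hAi : ∀ i, HasGaussianLaw (fun ω => A ω i) P := fun i =>
    hAB.fst.map_fun (ContinuousLinearMap.proj (R := ℝ) (φ := fun _ : ι => ℝ) i)
  have hBi : ∀ i, HasGaussianLaw (fun ω => B ω i) P := fun i =>
    hAB.snd.map_fun (ContinuousLinearMap.proj (R := ℝ) (φ := fun _ : ι => ℝ) i)
  have hAm := hAB.fst.aemeasurable
  have hBm := hAB.snd.aemeasurable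
  set Z : ℝ → Ω → ι → ℝ := fun θ ω => Real.cos θ • A ω + Real.sin θ • B ω with hZ
  set Z' : ℝ → ι → Ω → ℝ := fun θ i ω => (-Real.sin θ) * A ω i + Real.cos θ * B ω i with hZ'
  have hZm : ∀ θ, AEMeasurable (Z θ) P := fun θ => by
    have h := (hAm.const_smul (Real.cos θ)).add (hBm.const_smul (Real.sin θ))
    exact h
  have hZd : ∀ ω θ i, HasDerivAt (fun θ => Z θ ω i) (Z' θ i ω) θ := by
    intro ω θ i
    simp only [hZ, hZ', Pi.add_apply, Pi.smul_apply, smul_eq_mul]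
    exact ((Real.hasDerivAt_cos θ).mul_const _).add ((Real.hasDerivAt_sin θ).mul_const _)
  have hZ'i : ∀ θ i, Integrable (Z' θ i) P := fun θ i =>
    ((hAi i).integrable.const_mul _).add ((hBi i).integrable.const_mul _)
  set bound : Ω → ℝ := fun ω => ∑ i, (|A ω i| + |B ω i|) with hbound
  have hboundi : Integrable bound P := by
    refine integrable_finsetSum _ fun i _ => ?_
    exact (hAi i).integrable.abs.add (hBi i).integrable.abs
  have hlm : ∀ θ, AEStronglyMeasurable (fun ω => lse c (Z θ ω)) P := fun θ =>
    (lse_cont c).comp_aestronglyMeasurable (hZm θ).aestronglyMeasurable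
  have hsm : ∀ i θ, AEStronglyMeasurable (fun ω => smx c i (Z θ ω)) P := fun i θ =>
    (smx_cont c i).comp_aestronglyMeasurable (hZm θ).aestronglyMeasurable
  have habs : ∀ a b x y : ℝ, |a| ≤ 1 → |b| ≤ 1 → |a * x + b * y| ≤ |x| + |y| := by
    intro a b x y ha hb
    refine (abs_add_le _ _).trans ?_
    rw [abs_mul, abs_mul]
    have h1 := mul_le_mul_of_nonneg_right ha (abs_nonneg x)
    have h2 := mul_le_mul_of_nonneg_right hb (abs_nonneg y)
    linarith
  have hli : ∀ θ, Integrable (fun ω => lse c (Z θ ω)) P := by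
    intro θ
    refine Integrable.mono' ((integrable_const |lse c 0|).add hboundi) (hlm θ) (.of_forall fun ω => ?_)
    refine (lse_bound c _).trans ?_
    simp only [Pi.add_apply, hbound]
    gcongr with i _
    simp only [hZ, Pi.add_apply, Pi.smul_apply, smul_eq_mul]
    exact habs _ _ _ _ (Real.abs_cos_le_one _) (Real.abs_sin_le_one _)
  have hderiv : ∀ θ, HasDerivAt (fun θ => ∫ ω, lse c (Z θ ω) ∂P)
      (∫ ω, ∑ i, smx c i (Z θ ω) * Z' θ i ω ∂P) θ := by
    intro θ
    refine (hasDerivAt_integral_of_dominated_loc_of_deriv_le (bound := bound) (s := Set.univ)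
      (F' := fun θ ω => ∑ i, smx c i (Z θ ω) * Z' θ i ω)
      Filter.univ_mem (.of_forall hlm) (hli θ) ?_ ?_ hboundi ?_).2
    · refine Finset.aestronglyMeasurable_fun_sum _ fun i _ => ?_
      exact (hsm i θ).mul (hZ'i θ i).aestronglyMeasurable
    · refine .of_forall fun ω x _ => ?_
      refine (Finset.abs_sum_le_sum_abs _ _).trans (Finset.sum_le_sum fun i _ => ?_)
      rw [abs_mul]
      refine (mul_le_of_le_one_left (abs_nonneg _) (smx_abs_le c i _)).trans ?_
      exact habs _ _ _ _ (by rw [abs_neg]; exact Real.abs_sin_le_one _) (Real.abs_cos_le_one _)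
    · refine .of_forall fun ω x _ => ?_
      exact lse_deriv c (fun θ => Z θ ω) (fun i => Z' x i ω) x (hZd ω x)
  have hcovZ : ∀ θ i j, cov[Z' θ i, fun ω => Z θ ω j; P] = Real.sin θ * Real.cos θ *
      (cov[fun ω => B ω i, fun ω => B ω j; P] - cov[fun ω => A ω i, fun ω => A ω j; P]) := by
    intro θ i j
    have mA := fun i => (hAi i).memLp_two
    have mB := fun i => (hBi i).memLp_two
    have e1 : Z' θ i = (-Real.sin θ) • (fun ω => A ω i) + Real.cos θ • (fun ω => B ω i) := by
      ext ω; simp [hZ']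
    have e2 : (fun ω => Z θ ω j) = (Real.cos θ) • (fun ω => A ω j) + Real.sin θ • (fun ω => B ω j) := by
      ext ω; simp [hZ]
    rw [e1, e2, covariance_add_left ((mA i).const_smul _) ((mB i).const_smul _)
      (((mA j).const_smul _).add ((mB j).const_smul _)),
      covariance_add_right ((mA i).const_smul _) ((mA j).const_smul _) ((mB j).const_smul _),
      covariance_add_right ((mB i).const_smul _) ((mA j).const_smul _) ((mB j).const_smul _)]
    simp only [covariance_smul_left, covariance_smul_right, hcov]
    rw [covariance_comm (fun ω => B ω i) (fun ω => A ω j), hcov]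
    ring
  have hcovInc : ∀ i j, 0 ≤ (cov[fun ω => B ω i, fun ω => B ω i; P] - cov[fun ω => A ω i, fun ω => A ω i; P])
      + (cov[fun ω => B ω j, fun ω => B ω j; P] - cov[fun ω => A ω j, fun ω => A ω j; P])
      - 2 * (cov[fun ω => B ω i, fun ω => B ω j; P] - cov[fun ω => A ω i, fun ω => A ω j; P]) := by
    intro i j
    have h := hinc i j
    have mA := fun i => (hAi i).memLp_two
    have mB := fun i => (hBi i).memLp_two
    rw [← covariance_self (X := fun ω => A ω i - A ω j) ((mA i).sub (mA j)).aemeasurable, 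
      ← covariance_self (X := fun ω => B ω i - B ω j) ((mB i).sub (mB j)).aemeasurable] at h
    rw [covariance_fun_sub_fun_sub (mA i) (mA j) (mA i) (mA j),
      covariance_fun_sub_fun_sub (mB i) (mB j) (mB i) (mB j)] at h
    rw [covariance_comm (fun ω => A ω j) (fun ω => A ω i), 
      covariance_comm (fun ω => B ω j) (fun ω => B ω i)] at h
    linarith
  have hsi : ∀ θ i, Integrable (fun ω => smx c i (Z θ ω)) P := fun θ i => 
    Integrable.of_bound (C := 1) (hsm i θ) (.of_forall fun _ => smx_abs_le c i _)
  have hHi : ∀ θ i j, Integrable (fun ω => smx c i (Z θ ω) * ((if i = j then 1 else 0) - smx c j (Z θ ω))) P := by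
    intro θ i j
    refine Integrable.bdd_mul (c := 1) ((integrable_const _).sub (hsi θ j)) (hsm i θ) (.of_forall fun _ => smx_abs_le c i _)
  have hval : ∀ θ, ∫ ω, ∑ i, smx c i (Z θ ω) * Z' θ i ω ∂P = Real.sin θ * Real.cos θ *
      ∫ ω, ∑ i, ∑ j, (cov[fun ω => B ω i, fun ω => B ω j; P] - cov[fun ω => A ω i, fun ω => A ω j; P]) *
        (smx c i (Z θ ω) * ((if i = j then 1 else 0) - smx c j (Z θ ω))) ∂P := by
    intro θ
    rw [integral_finsetSum, integral_finsetSum, Finset.mul_sum]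
    · refine Finset.sum_congr rfl fun i _ => ?_
      have hg : HasGaussianLaw (fun ω => (Z' θ i ω, Z θ ω)) P := by
        let p := ContinuousLinearMap.fst ℝ (ι → ℝ) (ι → ℝ)
        let q := ContinuousLinearMap.snd ℝ (ι → ℝ) (ι → ℝ)
        let e := ContinuousLinearMap.proj (R := ℝ) (φ := fun _ : ι => ℝ) i
        convert! hAB.map_fun ((e.comp ((-Real.sin θ) • p + Real.cos θ • q)).prod (Real.cos θ • p + Real.sin θ • q)) using 2 with ω
      have hz : ∫ ω, Z' θ i ω ∂P = 0 := by
        simp only [hZ']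
        rw [integral_add ((hAi i).integrable.const_mul _) ((hBi i).integrable.const_mul _),
          integral_const_mul, integral_const_mul, hA0, hB0]; simp
      have := gaussian_ibp hg hz (smx c i) (fun j z => smx c i z * ((if i = j then 1 else 0) - smx c j z)) 2
        (fun d z t => smx_deriv c i (fun t => t • d + z) d t fun k => by
          simp only [Pi.add_apply, Pi.smul_apply, smul_eq_mul]
          simpa using ((hasDerivAt_id t).mul_const (d k)).add_const (z k))
        (smx_cont c i) (fun j => (smx_cont c i).mul (continuous_const.sub (smx_cont c j)))
        (fun z => (smx_abs_le c i z).trans one_le_two) (fun j z => by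
          rw [abs_mul]
          have h1 := smx_abs_le c i z
          have h2 : |(if i = j then (1:ℝ) else 0) - smx c j z| ≤ 1 := by
            have := smx_nonneg c j z
            have := smx_le_one c j z
            rw [abs_le]; split_ifs <;> constructor <;> linarith
          nlinarith [abs_nonneg (smx c i z)])
      simp_rw [mul_comm (smx c i (Z θ _)) (Z' θ i _)]
      rw [this, integral_finsetSum, Finset.mul_sum]
      · refine Finset.sum_congr rfl fun j _ => ?_
        rw [integral_const_mul, hcovZ]; ring
      · intro j _; exact (hHi θ i j).const_mul _
    · intro i _; exact integrable_finsetSum _ fun j _ => (hHi θ i j).const_mul _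
    · intro i _
      exact Integrable.bdd_mul (c := 1) (hZ'i θ i) (hsm i θ) (.of_forall fun _ => smx_abs_le c i _)
  have hmono : MonotoneOn (fun θ => ∫ ω, lse c (Z θ ω) ∂P) (Set.Icc 0 (π / 2)) := by
    refine monotoneOn_of_deriv_nonneg (convex_Icc _ _) 
      (fun θ _ => (hderiv θ).continuousAt.continuousWithinAt)
      (fun θ _ => (hderiv θ).differentiableAt.differentiableWithinAt) ?_
    intro θ hθ
    rw [interior_Icc] at hθ
    rw [(hderiv θ).deriv, hval]
    refine mul_nonneg (mul_nonneg (Real.sin_nonneg_of_nonneg_of_le_pi hθ.1.le (by linarith [hθ.2, Real.pi_pos])) 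
      (Real.cos_nonneg_of_neg_pi_div_two_le_of_le (by linarith [hθ.1, Real.pi_pos]) hθ.2.le)) ?_
    refine integral_nonneg fun ω => ?_
    exact sum_ident (fun i => smx c i (Z θ ω)) _ (fun i => smx_nonneg c i _) (smx_sum c _) hcovInc
  have := hmono (a := 0) (b := π / 2) ⟨le_rfl, by positivity⟩ ⟨by positivity, le_rfl⟩ (by positivity)
  simpa [hZ] using this

lemma sf_max {Ω ι : Type*} [MeasurableSpace Ω] [Fintype ι] [Nonempty ι] {P : Measure Ω}
    {A B : Ω → ι → ℝ} (hAB : HasGaussianLaw (fun ω => (A ω, B ω)) P)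
    (hA0 : ∀ i, ∫ ω, A ω i ∂P = 0) (hB0 : ∀ i, ∫ ω, B ω i ∂P = 0)
    (hcov : ∀ i j, cov[fun ω => A ω i, fun ω => B ω j; P] = 0)
    (hinc : ∀ i j, Var[fun ω => A ω i - A ω j; P] ≤ Var[fun ω => B ω i - B ω j; P])
    (c : ι → ℝ) (F₁ F₂ : Ω → ℝ) (hF₁ : Integrable F₁ P) (hF₂ : Integrable F₂ P)
    (h₁ : ∀ ω, ∃ i, F₁ ω ≤ A ω i + c i) (h₂ : ∀ ω i, B ω i + c i ≤ F₂ ω) :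
    ∫ ω, F₁ ω ∂P ≤ ∫ ω, F₂ ω ∂P := by
  have := hAB.isProbabilityMeasure
  have hAi : ∀ i, HasGaussianLaw (fun ω => A ω i) P := fun i =>
    hAB.fst.map_fun (ContinuousLinearMap.proj (R := ℝ) (φ := fun _ : ι => ℝ) i)
  have hBi : ∀ i, HasGaussianLaw (fun ω => B ω i) P := fun i =>
    hAB.snd.map_fun (ContinuousLinearMap.proj (R := ℝ) (φ := fun _ : ι => ℝ) i)
  set n : ℝ := ((Fintype.card ι : ℕ) : ℝ) with hn
  have hn0 : 0 < n := by simp [hn, Fintype.card_pos]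
  have hn1 : 1 ≤ n := by simp only [hn]; exact_mod_cast Fintype.card_pos (α := ι)
  have main : ∀ β : ℝ, 0 < β → β * ∫ ω, F₁ ω ∂P ≤ Real.log n + β * ∫ ω, F₂ ω ∂P := by
    intro β hβ
    have hg : HasGaussianLaw (fun ω => (β • A ω, β • B ω)) P := by
      convert! hAB.fun_smul β using 2
    have hsf := sf_lse (A := fun ω => β • A ω) (B := fun ω => β • B ω) hg
      (fun i => by simp [integral_const_mul, hA0]) (fun i => by simp [integral_const_mul, hB0])
      (fun i j => by
        simp only [Pi.smul_apply, smul_eq_mul]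
        rw [covariance_const_mul_left, covariance_const_mul_right, hcov]; simp)
      (fun i j => by
        simp only [Pi.smul_apply, smul_eq_mul, ← mul_sub]
        rw [variance_const_mul, variance_const_mul]
        exact mul_le_mul_of_nonneg_left (hinc i j) (sq_nonneg _)) (β • c)
    have hint : ∀ D : Ω → ι → ℝ, HasGaussianLaw D P → (∀ i, Integrable (fun ω => D ω i) P) → 
        Integrable (fun ω => lse (β • c) (β • D ω)) P := by
      intro D hD hDi
      refine Integrable.mono' ((integrable_const |lse (β • c) 0|).add 
        (integrable_finsetSum Finset.univ fun i _ => ((hDi i).const_mul β).abs)) ?_ (.of_forall fun ω => ?_)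
      · exact (lse_cont _).comp_aestronglyMeasurable (hD.aemeasurable.const_smul β).aestronglyMeasurable
      · exact lse_bound _ _
    calc β * ∫ ω, F₁ ω ∂P = ∫ ω, β * F₁ ω ∂P := (integral_const_mul _ _).symm
      _ ≤ ∫ ω, lse (β • c) (β • A ω) ∂P := by
        refine integral_mono (hF₁.const_mul _) (hint A hAB.fst fun i => (hAi i).integrable) fun ω => ?_
        obtain ⟨i, hi⟩ := h₁ ω
        have h3 : β * F₁ ω ≤ β * A ω i + β * c i := by
          rw [← mul_add]; exact mul_le_mul_of_nonneg_left hi hβ.le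
        refine h3.trans ?_
        unfold lse
        rw [Real.le_log_iff_exp_le (sexp_pos _ _)]
        exact Finset.single_le_sum (f := fun i => Real.exp ((β • A ω) i + (β • c) i)) 
          (fun i _ => (Real.exp_pos _).le) (Finset.mem_univ i)
      _ ≤ ∫ ω, lse (β • c) (β • B ω) ∂P := hsf
      _ ≤ ∫ ω, (Real.log n + β * F₂ ω) ∂P := by
        refine integral_mono (hint B hAB.snd fun i => (hBi i).integrable) 
          ((integrable_const _).add (hF₂.const_mul _)) fun ω => ?_
        show lse (β • c) (β • B ω) ≤ Real.log n + β * F₂ ω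
        unfold lse
        rw [Real.log_le_iff_le_exp (sexp_pos _ _), Real.exp_add, Real.exp_log hn0]
        calc ∑ i, Real.exp ((β • B ω) i + (β • c) i) ≤ ∑ i : ι, Real.exp (β * F₂ ω) := by
              refine Finset.sum_le_sum fun i _ => Real.exp_le_exp.2 ?_
              simp only [Pi.smul_apply, smul_eq_mul, ← mul_add]
              exact mul_le_mul_of_nonneg_left (h₂ ω i) hβ.le
          _ = n * Real.exp (β * F₂ ω) := by simp [hn]
      _ = Real.log n + β * ∫ ω, F₂ ω ∂P := by
        rw [integral_add (integrable_const _) (hF₂.const_mul _), integral_const_mul]; simp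
  refine le_of_forall_pos_le_add fun ε hε => ?_
  have hl : 0 ≤ Real.log n := Real.log_nonneg hn1
  have hβ : 0 < (Real.log n + 1) / ε := by positivity
  have h := main _ hβ
  have h5 : (Real.log n + 1) / ε * (∫ ω, F₁ ω ∂P - ∫ ω, F₂ ω ∂P) ≤ Real.log n + 1 := by linarith
  rw [div_mul_eq_mul_div, div_le_iff₀ hε] at h5
  have := le_of_mul_le_mul_left h5 (by linarith)
  linarith

lemma layer_pt {m : ℝ} (hm : 1 < m) {x : ℝ} (hx : 0 ≤ x) :
    ENNReal.ofReal (x ^ m) = ∫⁻ u in Set.Ioi (0:ℝ), ENNReal.ofReal (m * (m - 1) * u ^ (m - 2)) * ENNReal.ofReal (x - u) := by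
  have hs : Set.Ioi (0:ℝ) = Set.Ioc 0 x ∪ Set.Ioi x := (Set.Ioc_union_Ioi_eq_Ioi hx).symm
  have h0 : ∫⁻ u in Set.Ioi x, ENNReal.ofReal (m * (m - 1) * u ^ (m - 2)) * ENNReal.ofReal (x - u) = 0 := by
    rw [setLIntegral_congr_fun (g := fun _ => 0) measurableSet_Ioi]
    · simp
    · intro u hu
      simp only
      rw [ENNReal.ofReal_of_nonpos (by linarith [Set.mem_Ioi.1 hu] : x - u ≤ 0), mul_zero]
  rw [hs, lintegral_union measurableSet_Ioi (Set.disjoint_left.2 fun a ha hb => not_lt.2 ha.2 hb), h0, add_zero]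
  have h1 : ∀ u ∈ Set.Ioc 0 x, ENNReal.ofReal (m * (m - 1) * u ^ (m - 2)) * ENNReal.ofReal (x - u)
      = ENNReal.ofReal (m * (m - 1) * x * u ^ (m - 2) - m * (m - 1) * u ^ (m - 1)) := by
    intro u hu
    have hu0 : 0 < u := hu.1
    rw [← ENNReal.ofReal_mul (by have : 0 < m - 1 := by linarith
                                 positivity)]
    congr 1
    have : u ^ (m - 1) = u ^ (m - 2) * u := by
      rw [← Real.rpow_add_one hu0.ne']; congr 1; ring
    rw [this]; ring
  rw [setLIntegral_congr_fun measurableSet_Ioc h1]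
  have i1 : IntervalIntegrable (fun u : ℝ => m * (m - 1) * x * u ^ (m - 2)) volume 0 x :=
    (intervalIntegral.intervalIntegrable_rpow' (by linarith)).const_mul _
  have i2 : IntervalIntegrable (fun u : ℝ => m * (m - 1) * u ^ (m - 1)) volume 0 x :=
    (intervalIntegral.intervalIntegrable_rpow' (by linarith)).const_mul _
  have i3 := (intervalIntegrable_iff_integrableOn_Ioc_of_le hx).1 (i1.sub i2)
  rw [← ofReal_integral_eq_lintegral_ofReal i3]
  · rw [← intervalIntegral.integral_of_le hx, intervalIntegral.integral_sub i1 i2,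
      intervalIntegral.integral_const_mul, intervalIntegral.integral_const_mul,
      integral_rpow (.inl (by linarith)), integral_rpow (.inl (by linarith))]
    congr 1
    have e1 : m - 2 + 1 = m - 1 := by ring
    have e2 : m - 1 + 1 = m := by ring
    rw [e1, e2, Real.zero_rpow (by linarith), Real.zero_rpow (by linarith)]
    have hm1 : m - 1 ≠ 0 := by linarith
    have hm0 : m ≠ 0 := by linarith
    have : x ^ m = x ^ (m - 1) * x := by
      rcases hx.eq_or_lt with rfl | hx
      · simp [Real.zero_rpow hm0]
      · rw [← Real.rpow_add_one hx.ne', e2]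
    field_simp
    rw [this]; ring
  · refine (ae_restrict_iff' measurableSet_Ioc).2 (.of_forall fun u hu => ?_)
    have hu0 : 0 < u := hu.1
    have : u ^ (m - 1) = u ^ (m - 2) * u := by
      rw [← Real.rpow_add_one hu0.ne']; congr 1; ring
    simp only [Pi.zero_apply, this]
    have h3 : 0 ≤ m * (m - 1) * u ^ (m - 2) * (x - u) := by
      have : 0 < m - 1 := by linarith
      have : 0 ≤ x - u := by linarith [hu.2]
      positivity
    linarith

lemma layer_cmp {Ω : Type*} [MeasurableSpace Ω] {P : Measure Ω} [IsProbabilityMeasure P]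
    {V₁ V₂ : Ω → ℝ} (hm₁ : Measurable V₁) (hm₂ : Measurable V₂) (h₁ : ∀ ω, 0 ≤ V₁ ω) (h₂ : ∀ ω, 0 ≤ V₂ ω)
    (hi₁ : Integrable V₁ P) (hi₂ : Integrable V₂ P)
    (h : ∀ u, 0 ≤ u → ∫ ω, max u (V₁ ω) ∂P ≤ ∫ ω, max u (V₂ ω) ∂P) {m : ℝ} (hm : 1 ≤ m) :
    ∫⁻ ω, ENNReal.ofReal (V₁ ω ^ m) ∂P ≤ ∫⁻ ω, ENNReal.ofReal (V₂ ω ^ m) ∂P := by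
  have key : ∀ u, 0 ≤ u → ∫⁻ ω, ENNReal.ofReal (V₁ ω - u) ∂P ≤ ∫⁻ ω, ENNReal.ofReal (V₂ ω - u) ∂P := by
    intro u hu
    have e : ∀ V : Ω → ℝ, Integrable V P → ∫⁻ ω, ENNReal.ofReal (V ω - u) ∂P = 
        ENNReal.ofReal (∫ ω, max u (V ω) ∂P - u) := by
      intro V hV
      have hi : Integrable (fun ω => max u (V ω)) P := (integrable_const u).sup hV
      have : ∫ ω, max u (V ω) ∂P - u = ∫ ω, (max u (V ω) - u) ∂P := by
        rw [integral_sub hi (integrable_const _)]; simp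
      rw [this, ofReal_integral_eq_lintegral_ofReal (f := fun ω => max u (V ω) - u) (hi.sub (integrable_const _)) (.of_forall fun ω => by simp)]
      refine lintegral_congr fun ω => ?_
      rcases le_total u (V ω) with h | h
      · simp [h]
      · rw [ENNReal.ofReal_of_nonpos (by linarith)]; simp [h]
    rw [e V₁ hi₁, e V₂ hi₂]
    exact ENNReal.ofReal_le_ofReal (by linarith [h u hu])
  rcases hm.eq_or_lt with rfl | hm
  · simpa using key 0 le_rfl
  have e : ∀ V : Ω → ℝ, Measurable V → (∀ ω, 0 ≤ V ω) → ∫⁻ ω, ENNReal.ofReal (V ω ^ m) ∂P = 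
      ∫⁻ u in Set.Ioi (0:ℝ), ENNReal.ofReal (m * (m - 1) * u ^ (m - 2)) * ∫⁻ ω, ENNReal.ofReal (V ω - u) ∂P := by
    intro V hV hV0
    simp_rw [fun ω => layer_pt hm (hV0 ω)]
    rw [lintegral_lintegral_swap]
    · refine lintegral_congr fun u => ?_
      rw [lintegral_const_mul _ (by fun_prop)]
    · apply Measurable.aemeasurable
      unfold Function.uncurry
      fun_prop
  rw [e V₁ hm₁ h₁, e V₂ hm₂ h₂]
  refine setLIntegral_mono' measurableSet_Ioi fun u hu => ?_
  refine mul_le_mul_right ?_ _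
  exact key u (le_of_lt hu)

lemma cgv_law {Ω : Type*} [MeasurableSpace Ω] {k : ℕ} {P : Measure Ω}
    {X : Ω → Fin k → ℝ} (hXmeas : Measurable X) (hX : IsCenteredGaussianVec P X) :
    HasGaussianLaw X P := by
  constructor
  refine isGaussian_of_map_eq_gaussianReal fun L => ?_
  refine ⟨0, (variance (fun ω => ∑ i, L (Pi.single i 1) * X ω i) P).toNNReal, ?_⟩
  · rw [Measure.map_map (by fun_prop) hXmeas]
    have h := hX (fun i => L (Pi.single i 1))
    have h2 : (L ∘ X) = (fun ω => ∑ i, L (Pi.single i 1) * X ω i) := by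
      funext ω
      have := LinearMap.pi_apply_eq_sum_univ (L : (Fin k → ℝ) →ₗ[ℝ] ℝ) (X ω)
      simp only [Function.comp]
      rw [ContinuousLinearMap.coe_coe] at this
      rw [this]
      refine Finset.sum_congr rfl fun i _ => ?_
      rw [smul_eq_mul, mul_comm]
      congr 2
      ext j
      simp [Pi.single_apply, eq_comm]
    rw [h2]
    exact h

lemma cgv_mean {Ω : Type*} [MeasurableSpace Ω] {k : ℕ} {P : Measure Ω}
    {X : Ω → Fin k → ℝ} (hXmeas : Measurable X) (hX : IsCenteredGaussianVec P X) (i : Fin k) :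
    ∫ ω, X ω i ∂P = 0 := by
  have h := hX (Pi.single i 1)
  simp only [Pi.single_apply, ite_mul, one_mul, zero_mul, Finset.sum_ite_eq', Finset.mem_univ,
    if_true] at h
  have h2 : ∫ x, x ∂(Measure.map (fun ω => X ω i) P) = ∫ ω, X ω i ∂P :=
    integral_map (by fun_prop) (by fun_prop)
  rw [← h2, h]
  simp

lemma iSup_abs_eq_norm {k : ℕ} [Nonempty (Fin k)] (x : Fin k → ℝ) : (⨆ i, |x i|) = ‖x‖ := by
  apply le_antisymm
  · exact ciSup_le fun i => by simpa using norm_le_pi_norm x i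
  · rw [pi_norm_le_iff_of_nonempty]
    intro i
    exact le_ciSup (f := fun i => |x i|) (Set.finite_range _).bddAbove i

lemma exists_abs_eq_norm {k : ℕ} [Nonempty (Fin k)] (x : Fin k → ℝ) : ∃ i, |x i| = ‖x‖ := by
  rw [← iSup_abs_eq_norm]
  exact exists_eq_ciSup_of_finite

lemma quad_expand {Ω : Type*} [MeasurableSpace Ω] {P : Measure Ω} {U V : Ω → ℝ}
    (hU : MemLp U 2 P) (hV : MemLp V 2 P) (a b : ℝ) :
    ∫ ω, (a * U ω - b * V ω) ^ 2 ∂P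
      = a ^ 2 * ∫ ω, U ω ^ 2 ∂P - 2 * a * b * ∫ ω, U ω * V ω ∂P + b ^ 2 * ∫ ω, V ω ^ 2 ∂P := by
  have h1 := hU.integrable_sq
  have h2 := hV.integrable_sq
  have h3 : Integrable (fun ω => U ω * V ω) P := hU.integrable_mul hV
  have : ∀ ω, (a * U ω - b * V ω) ^ 2
      = a ^ 2 * U ω ^ 2 - 2 * a * b * (U ω * V ω) + b ^ 2 * V ω ^ 2 := fun ω => by ring
  simp_rw [this]
  rw [integral_add (by fun_prop) (by fun_prop), integral_sub (by fun_prop) (by fun_prop),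
    integral_const_mul, integral_const_mul, integral_const_mul]

def sgnO {k : ℕ} : Option (Fin k × Bool) → ℝ
  | none => 0
  | some (_, true) => 1
  | some (_, false) => -1

def actO {k : ℕ} : Option (Fin k × Bool) → ℝ
  | none => 0
  | some _ => 1

def idxO {k : ℕ} (i0 : Fin k) : Option (Fin k × Bool) → Fin k
  | none => i0
  | some (i, _) => i

lemma joint_law {Ω : Type*} [MeasurableSpace Ω] {k : ℕ} {P : Measure Ω} [IsProbabilityMeasure P]
    {X Y : Ω → Fin k → ℝ} (hXmeas : Measurable X) (hYmeas : Measurable Y)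
    (hX : HasGaussianLaw X P) (hY : HasGaussianLaw Y P) (i0 : Fin k) :
    HasGaussianLaw (fun ω : Ω × Ω × Ω =>
      ((fun e : Option (Fin k × Bool) => sgnO e * X ω.1 (idxO i0 e)),
       (fun e : Option (Fin k × Bool) => actO e * Y ω.2.1 (idxO i0 e) + sgnO e * Y ω.2.2 i0)))
      (P.prod (P.prod P)) := by
  have hT : HasGaussianLaw (fun ω : Ω × Ω × Ω => (X ω.1, Y ω.2.1, Y ω.2.2))
      (P.prod (P.prod P)) := by
    constructor
    have := hX.isGaussian_map
    have := hY.isGaussian_map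
    have h : (P.prod (P.prod P)).map (fun ω : Ω × Ω × Ω => (X ω.1, Y ω.2.1, Y ω.2.2))
        = (P.map X).prod ((P.map Y).prod (P.map Y)) := by
      rw [Measure.map_prod_map _ _ hYmeas hYmeas,
        Measure.map_prod_map _ _ hXmeas (by fun_prop)]
      rfl
    rw [h]
    infer_instance
  let T : ((Fin k → ℝ) × (Fin k → ℝ) × (Fin k → ℝ)) →ₗ[ℝ]
      ((Option (Fin k × Bool) → ℝ) × (Option (Fin k × Bool) → ℝ)) :=
    { toFun := fun z => ((fun e => sgnO e * z.1 (idxO i0 e)),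
        (fun e => actO e * z.2.1 (idxO i0 e) + sgnO e * z.2.2 i0))
      map_add' := by
        intro x y
        ext e <;> simp <;> ring
      map_smul' := by
        intro c x
        ext e <;> simp <;> ring }
  exact hT.map_fun (LinearMap.toContinuousLinearMap T)

lemma incr_cmp {k : ℕ} (i0 : Fin k) (mx my : Fin k → Fin k → ℝ)
    (hinc : ∀ i j, mx i i - 2 * mx i j + mx j j ≤ my i i - 2 * my i j + my j j)
    (hpx : ∀ i j, 0 ≤ mx i i - 2 * mx i j + mx j j)
    (hpy : ∀ i j, 0 ≤ my i i - 2 * my i j + my j j)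
    (hd : ∀ i, 0 ≤ my i i)
    (h0 : ∀ i, mx i i ≤ my i0 i0) (e f : Option (Fin k × Bool)) :
    sgnO e ^ 2 * mx (idxO i0 e) (idxO i0 e)
      - 2 * sgnO e * sgnO f * mx (idxO i0 e) (idxO i0 f)
      + sgnO f ^ 2 * mx (idxO i0 f) (idxO i0 f) ≤
    (actO e ^ 2 * my (idxO i0 e) (idxO i0 e)
      - 2 * actO e * actO f * my (idxO i0 e) (idxO i0 f)
      + actO f ^ 2 * my (idxO i0 f) (idxO i0 f)) + (sgnO e - sgnO f) ^ 2 * my i0 i0 := by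
  rcases e with _ | ⟨i, _ | _⟩ <;> rcases f with _ | ⟨j, _ | _⟩ <;>
    simp only [sgnO, actO, idxO]
  · norm_num
  · linarith [h0 j, hd j, hd i0]
  · linarith [h0 j, hd j, hd i0]
  · linarith [h0 i, hd i, hd i0]
  · linarith [hinc i j]
  · linarith [h0 i, h0 j, hpx i j, hpy i j]
  · linarith [h0 i, hd i, hd i0]
  · linarith [h0 i, h0 j, hpx i j, hpy i j]
  · linarith [hinc i j]

lemma max_cmp {Ω : Type*} [MeasurableSpace Ω] {k : ℕ} {P : Measure Ω} [IsProbabilityMeasure P]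
    [Nonempty (Fin k)]
    {X Y : Ω → Fin k → ℝ} (hXmeas : Measurable X) (hYmeas : Measurable Y)
    (hX : HasGaussianLaw X P) (hY : HasGaussianLaw Y P)
    (hX0 : ∀ i, ∫ ω, X ω i ∂P = 0) (hY0 : ∀ i, ∫ ω, Y ω i ∂P = 0)
    (hincr : ∀ i j, ∫ ω, (X ω i - X ω j) ^ 2 ∂P ≤ ∫ ω, (Y ω i - Y ω j) ^ 2 ∂P)
    (i0 : Fin k) (h0 : ∀ i, ∫ ω, (X ω i) ^ 2 ∂P ≤ ∫ ω, (Y ω i0) ^ 2 ∂P) (u : ℝ) :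
    ∫ ω : Ω × Ω × Ω, max u ‖X ω.1‖ ∂(P.prod (P.prod P))
      ≤ ∫ ω : Ω × Ω × Ω, max u (‖Y ω.2.1‖ + ‖Y ω.2.2‖) ∂(P.prod (P.prod P)) := by
  have hXi : ∀ i, MemLp (fun ω => X ω i) 2 P := fun i =>
    (hX.map_fun (ContinuousLinearMap.proj (R := ℝ) (φ := fun _ : Fin k => ℝ) i)).memLp_two
  have hYi : ∀ i, MemLp (fun ω => Y ω i) 2 P := fun i =>
    (hY.map_fun (ContinuousLinearMap.proj (R := ℝ) (φ := fun _ : Fin k => ℝ) i)).memLp_two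
  have hXn : Integrable (fun ω => ‖X ω‖) P := hX.integrable.norm
  have hYn : Integrable (fun ω => ‖Y ω‖) P := hY.integrable.norm
  have hB2 : ∀ i, MemLp (fun z : Ω × Ω => Y z.1 i) 2 (P.prod P) := fun i => (hYi i).comp_fst P
  have hB3 : MemLp (fun z : Ω × Ω => Y z.2 i0) 2 (P.prod P) := (hYi i0).comp_snd P
  have hBm : ∀ e : Option (Fin k × Bool),
      MemLp (fun z : Ω × Ω => actO e * Y z.1 (idxO i0 e) + sgnO e * Y z.2 i0) 2 (P.prod P) :=
    fun e => ((hB2 _).const_mul _).add (hB3.const_mul _)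
  have hB0 : ∀ e : Option (Fin k × Bool),
      ∫ z : Ω × Ω, actO e * Y z.1 (idxO i0 e) + sgnO e * Y z.2 i0 ∂(P.prod P) = 0 := by
    intro e
    rw [integral_add (((hB2 _).const_mul _).integrable (by norm_num))
      ((hB3.const_mul _).integrable (by norm_num)), integral_const_mul, integral_const_mul,
      integral_fun_fst (fun ω => Y ω (idxO i0 e)), integral_fun_snd (fun ω => Y ω i0), hY0, hY0]
    simp
  refine sf_max (joint_law hXmeas hYmeas hX hY i0) ?_ ?_ ?_ ?_
    (fun e => match e with
      | none => u
      | some _ => 0) _ _ ?_ ?_ ?_ ?_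
  · intro e
    rw [integral_fun_fst (fun ω => sgnO e * X ω (idxO i0 e)), integral_const_mul, hX0]
    simp
  · intro e
    rw [integral_fun_snd (fun z : Ω × Ω => actO e * Y z.1 (idxO i0 e) + sgnO e * Y z.2 i0), hB0]
    simp
  · intro e f
    exact covariance_fst_snd_prod (μ := P) (ν := P.prod P)
      (X := fun ω => sgnO e * X ω (idxO i0 e))
      (Y := fun z : Ω × Ω => actO f * Y z.1 (idxO i0 f) + sgnO f * Y z.2 i0)
      ((hXi _).const_mul _) (hBm f)
  · intro e f
    have hA : Var[fun ω : Ω × Ω × Ω => sgnO e * X ω.1 (idxO i0 e) - sgnO f * X ω.1 (idxO i0 f);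
        P.prod (P.prod P)]
        = ∫ ω, (sgnO e * X ω (idxO i0 e) - sgnO f * X ω (idxO i0 f)) ^ 2 ∂P := by
      have hi : ∫ ω, sgnO e * X ω (idxO i0 e) - sgnO f * X ω (idxO i0 f) ∂P = 0 := by
        rw [integral_sub (((hXi _).const_mul _).integrable (by norm_num))
          (((hXi _).const_mul _).integrable (by norm_num)), integral_const_mul,
          integral_const_mul, hX0, hX0]
        simp
      rw [variance_of_integral_eq_zero (by fun_prop)]
      · rw [integral_fun_fst
          (fun ω => (sgnO e * X ω (idxO i0 e) - sgnO f * X ω (idxO i0 f)) ^ 2)]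
        simp
      · rw [integral_fun_fst (fun ω => sgnO e * X ω (idxO i0 e) - sgnO f * X ω (idxO i0 f)), hi]
        simp
    have hB : Var[fun ω : Ω × Ω × Ω => actO e * Y ω.2.1 (idxO i0 e) + sgnO e * Y ω.2.2 i0
          - (actO f * Y ω.2.1 (idxO i0 f) + sgnO f * Y ω.2.2 i0);
        P.prod (P.prod P)]
        = ∫ ω, (actO e * Y ω (idxO i0 e) - actO f * Y ω (idxO i0 f)) ^ 2 ∂P
          + (sgnO e - sgnO f) ^ 2 * ∫ ω, Y ω i0 ^ 2 ∂P := by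
      have hi : ∫ ω, actO e * Y ω (idxO i0 e) - actO f * Y ω (idxO i0 f) ∂P = 0 := by
        rw [integral_sub (((hYi _).const_mul _).integrable (by norm_num))
          (((hYi _).const_mul _).integrable (by norm_num)), integral_const_mul,
          integral_const_mul, hY0, hY0]
        simp
      have e1 := (measurePreserving_snd (μ := P) (ν := P.prod P)).variance_fun_comp
        (f := fun z : Ω × Ω => (actO e * Y z.1 (idxO i0 e) - actO f * Y z.1 (idxO i0 f))
          + (sgnO e - sgnO f) * Y z.2 i0) (by fun_prop)
      have e2 := variance_add_prod (μ := P) (ν := P)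
        (X := fun ω => actO e * Y ω (idxO i0 e) - actO f * Y ω (idxO i0 f))
        (Y := fun ω => (sgnO e - sgnO f) * Y ω i0)
        (((hYi _).const_mul _).sub ((hYi _).const_mul _)) ((hYi _).const_mul _)
      have e3 : Var[fun ω => actO e * Y ω (idxO i0 e) - actO f * Y ω (idxO i0 f); P]
          = ∫ ω, (actO e * Y ω (idxO i0 e) - actO f * Y ω (idxO i0 f)) ^ 2 ∂P :=
        variance_of_integral_eq_zero (by fun_prop) hi
      have e4 : Var[fun ω => Y ω i0; P] = ∫ ω, Y ω i0 ^ 2 ∂P :=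
        variance_of_integral_eq_zero (by fun_prop) (hY0 i0)
      rw [e2, e3, variance_const_mul, e4] at e1
      rw [← e1]
      congr 1
      funext ω
      ring
    rw [hA, hB, quad_expand (hXi _) (hXi _), quad_expand (hYi _) (hYi _)]
    have qX := fun i j => quad_expand (hXi i) (hXi j) 1 1
    have qY := fun i j => quad_expand (hYi i) (hYi j) 1 1
    simp only [one_mul, one_pow, mul_one] at qX qY
    have := incr_cmp i0 (fun i j => ∫ ω, X ω i * X ω j ∂P) (fun i j => ∫ ω, Y ω i * Y ω j ∂P)
      (fun i j => ?_) (fun i j => ?_) (fun i j => ?_) (fun i => ?_) (fun i => ?_) e f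
    · simpa only [← pow_two] using this
    · simp only [← pow_two]
      rw [← qX, ← qY]
      exact hincr i j
    · simp only [← pow_two]
      rw [← qX]
      positivity
    · simp only [← pow_two]
      rw [← qY]
      positivity
    · simp only [← pow_two]
      positivity
    · simp only [← pow_two]
      exact h0 i
  · exact (integrable_const u).sup (hXn.comp_fst (P.prod P))
  · exact (integrable_const u).sup
      (((hYn.comp_fst P).add (hYn.comp_snd P)).comp_snd P)
  · intro ω
    rcases le_total ‖X ω.1‖ u with h | h
    · exact ⟨none, by simp [sgnO, h]⟩
    · obtain ⟨i, hi⟩ := exists_abs_eq_norm (X ω.1)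
      rw [max_eq_right h, ← hi]
      rcases abs_choice (X ω.1 i) with hh | hh
      · exact ⟨some (i, true), by simp [sgnO, idxO, hh]⟩
      · exact ⟨some (i, false), by simp [sgnO, idxO, hh]⟩
  · intro ω e
    have ha : ∀ i, |Y ω.2.1 i| ≤ ‖Y ω.2.1‖ := fun i => by simpa using norm_le_pi_norm (Y ω.2.1) i
    have hb : |Y ω.2.2 i0| ≤ ‖Y ω.2.2‖ := by simpa using norm_le_pi_norm (Y ω.2.2) i0
    rcases e with _ | ⟨i, _ | _⟩
    · simp [sgnO, actO]
    · refine le_trans ?_ (le_max_right _ _)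
      simp only [sgnO, actO, idxO]
      linarith [ha i, le_abs_self (Y ω.2.1 i), neg_abs_le (Y ω.2.2 i0)]
    · refine le_trans ?_ (le_max_right _ _)
      simp only [sgnO, actO, idxO]
      linarith [ha i, le_abs_self (Y ω.2.1 i), le_abs_self (Y ω.2.2 i0)]

lemma real_rpow_add_le {a b m : ℝ} (ha : 0 ≤ a) (hb : 0 ≤ b) (hm : 1 ≤ m) :
    (a + b) ^ m ≤ 2 ^ (m - 1) * (a ^ m + b ^ m) := by
  have := NNReal.rpow_add_le_mul_rpow_add_rpow ⟨a, ha⟩ ⟨b, hb⟩ hm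
  exact_mod_cast this

/-- **Remark.** If `X, Y` are centered Gaussian vectors in `ℝ^k` with
`E[(X_i - X_j)^2] ≤ E[(Y_i - Y_j)^2]` for all `i, j`, and
`max_i E[X_i^2] ≤ max_i E[Y_i^2]`, then for every `m ≥ 1`,
`E[(max_i |X_i|)^m] ≤ 2^(m-1) (2^(m/2) + 1) E[(max_i |Y_i|)^m]`. -/
theorem moment_comparison_increments_var_dominated
    {Ω : Type*} [MeasurableSpace Ω] {k : ℕ} (P : Measure Ω) [IsProbabilityMeasure P]
    (X Y : Ω → Fin k → ℝ) (hXmeas : Measurable X) (hYmeas : Measurable Y)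
    (hX : IsCenteredGaussianVec P X) (hY : IsCenteredGaussianVec P Y)
    (hincr : ∀ i j, ∫ ω, (X ω i - X ω j) ^ 2 ∂P ≤ ∫ ω, (Y ω i - Y ω j) ^ 2 ∂P)
    (hvar : (⨆ i, ∫ ω, (X ω i) ^ 2 ∂P) ≤ ⨆ i, ∫ ω, (Y ω i) ^ 2 ∂P)
    (m : ℝ) (hm : 1 ≤ m) :
    ∫ ω, (⨆ i, |X ω i|) ^ m ∂P
      ≤ 2 ^ (m - 1) * (2 ^ (m / 2) + 1) * ∫ ω, (⨆ i, |Y ω i|) ^ m ∂P := by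
  rcases isEmpty_or_nonempty (Fin k) with hk | hk
  · have : m ≠ 0 := by linarith
    simp [Real.iSup_of_isEmpty, Real.zero_rpow this]
  simp_rw [iSup_abs_eq_norm]
  have gX := cgv_law hXmeas hX
  have gY := cgv_law hYmeas hY
  obtain ⟨i0, hi0⟩ := exists_eq_ciSup_of_finite (f := fun i => ∫ ω, (Y ω i) ^ 2 ∂P)
  have h0 : ∀ i, ∫ ω, (X ω i) ^ 2 ∂P ≤ ∫ ω, (Y ω i0) ^ 2 ∂P := fun i => by
    rw [hi0]
    exact (le_ciSup (f := fun i => ∫ ω, (X ω i) ^ 2 ∂P) (Set.finite_range _).bddAbove i).trans hvar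
  have hXn : Integrable (fun ω => ‖X ω‖) P := gX.integrable.norm
  have hYn : Integrable (fun ω => ‖Y ω‖) P := gY.integrable.norm
  have hm0 : 0 < m := by linarith
  have hp : ∀ {Z : Ω → Fin k → ℝ}, HasGaussianLaw Z P → Integrable (fun ω => ‖Z ω‖ ^ m) P := by
    intro Z hZ
    have := (hZ.memLp (p := ENNReal.ofReal m) ENNReal.ofReal_ne_top).integrable_norm_rpow
      (by simpa using hm0) ENNReal.ofReal_ne_top
    simpa [ENNReal.toReal_ofReal hm0.le] using this
  have hpX := hp gX
  have hpY := hp gY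
  have hs : Integrable (fun ω : Ω × Ω × Ω => 2 ^ (m - 1) * (‖Y ω.2.1‖ ^ m + ‖Y ω.2.2‖ ^ m))
      (P.prod (P.prod P)) :=
    ((((hpY.comp_fst P).add (hpY.comp_snd P)).comp_snd P)).const_mul _
  have key := layer_cmp (P := P.prod (P.prod P)) (V₁ := fun ω => ‖X ω.1‖)
    (V₂ := fun ω => ‖Y ω.2.1‖ + ‖Y ω.2.2‖) (by fun_prop) (by fun_prop)
    (fun ω => by positivity) (fun ω => by positivity) (hXn.comp_fst (P.prod P))
    (((hYn.comp_fst P).add (hYn.comp_snd P)).comp_snd P)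
    (fun u _ => max_cmp hXmeas hYmeas gX gY (cgv_mean hXmeas hX) (cgv_mean hYmeas hY) hincr i0 h0 u)
    hm
  have key2 := key.trans (lintegral_mono fun ω => ENNReal.ofReal_le_ofReal
    (real_rpow_add_le (norm_nonneg (Y ω.2.1)) (norm_nonneg (Y ω.2.2)) hm))
  rw [← ofReal_integral_eq_lintegral_ofReal (hpX.comp_fst (P.prod P))
      (Filter.Eventually.of_forall fun ω => by positivity),
    ← ofReal_integral_eq_lintegral_ofReal hs (Filter.Eventually.of_forall fun ω => by positivity),
    ENNReal.ofReal_le_ofReal_iff (integral_nonneg fun ω => by positivity),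
    integral_fun_fst (fun ω => ‖X ω‖ ^ m), integral_const_mul,
    integral_fun_snd (fun z : Ω × Ω => ‖Y z.1‖ ^ m + ‖Y z.2‖ ^ m),
    integral_add (hpY.comp_fst P) (hpY.comp_snd P), integral_fun_fst (fun ω => ‖Y ω‖ ^ m),
    integral_fun_snd (fun ω => ‖Y ω‖ ^ m)] at key2
  simp only [probReal_univ, one_smul] at key2
  refine key2.trans ?_
  rw [mul_assoc]
  have h1 : (1 : ℝ) ≤ 2 ^ (m / 2) := Real.one_le_rpow (by norm_num) (by positivity)
  have h2 : 0 ≤ ∫ ω, ‖Y ω‖ ^ m ∂P := integral_nonneg fun ω => by positivity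
  refine mul_le_mul_of_nonneg_left ?_ (by positivity)
  nlinarith
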